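/- arXiv:1808.09026 — 3 statements merged into one kernel-verified Lean document; each statement's English description precedes it below -/
import Mathlib

section
/- Let K be a field, let V and W be finite-dimensional K-vector spaces, let f : V →ₗ[K] V satisfy f ∘ f = 0, and let g : W ≃ₗ[K] W be a linear automorphism. Set F = TensorProduct.map f g.toLinearMap : V ⊗[K] W → V ⊗[K] W. Then F ∘ F = 0, and there is a K-linear isomorphism between the homology ker(F) ⧸ im(F) and (ker(f) ⧸ im(f)) ⊗[K] W. (This is the general principle underlying the proof of Theorem 2 of the paper: twisting the differential of a chain complex by tensoring with an invertible endomorphism of W multiplies the homology by W.) -/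
open TensorProduct

/-- The dimension-free homology `ker F ⧸ im F` of a linear endomorphism `F`
(with `im F ⊆ ker F` when `F ∘ F = 0`), realized as the quotient of `ker F`
by the pullback of `range F`. -/
abbrev homologyOf {K : Type} [Field K] {V : Type} [AddCommGroup V] [Module K V]
    (F : V →ₗ[K] V) :=
  LinearMap.ker F ⧸ (LinearMap.range F).comap (LinearMap.ker F).subtype

theorem finrank_homologyOf_add {K : Type} [Field K] {V : Type} [AddCommGroup V] [Module K V]
    [FiniteDimensional K V] (F : V →ₗ[K] V) (hF : F ∘ₗ F = 0) :
    Module.finrank K (homologyOf F) + 2 * Module.finrank K (LinearMap.range F)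
      = Module.finrank K V := by
  have hle : LinearMap.range F ≤ LinearMap.ker F := LinearMap.range_le_ker_iff.mpr hF
  have h1 := Submodule.finrank_quotient_add_finrank
    ((LinearMap.range F).comap (LinearMap.ker F).subtype)
  have h2 := (Submodule.comapSubtypeEquivOfLe hle).finrank_eq
  have h3 := LinearMap.finrank_range_add_finrank_ker F
  unfold homologyOf
  omega

theorem finrank_range_map_equiv {K : Type} [Field K] {V W : Type} [AddCommGroup V] [Module K V]
    [AddCommGroup W] [Module K W] (f : V →ₗ[K] V) (g : W ≃ₗ[K] W) :
    Module.finrank K (LinearMap.range (TensorProduct.map f g.toLinearMap))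
      = Module.finrank K (LinearMap.range f) * Module.finrank K W := by
  have h : TensorProduct.map f g.toLinearMap =
      (LinearMap.range f).subtype.rTensor W ∘ₗ
        TensorProduct.map f.rangeRestrict g.toLinearMap := by
    apply TensorProduct.ext'
    intro x y
    simp
  have hs : Function.Surjective (TensorProduct.map f.rangeRestrict g.toLinearMap) :=
    TensorProduct.map_surjective f.surjective_rangeRestrict g.surjective
  have hi : Function.Injective ((LinearMap.range f).subtype.rTensor W) :=
    Module.Flat.rTensor_preserves_injective_linearMap _ (Submodule.injective_subtype _)
  rw [h, LinearMap.range_comp_of_range_eq_top _ (LinearMap.range_eq_top.mpr hs),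
    LinearMap.finrank_range_of_inj hi, Module.finrank_tensorProduct]

theorem stmt3 (K : Type) [Field K]
    (V W : Type) [AddCommGroup V] [Module K V] [FiniteDimensional K V]
    [AddCommGroup W] [Module K W] [FiniteDimensional K W]
    (f : V →ₗ[K] V) (hf : f ∘ₗ f = 0) (g : W ≃ₗ[K] W) :
    (TensorProduct.map f g.toLinearMap) ∘ₗ (TensorProduct.map f g.toLinearMap) = 0 ∧
    Nonempty (homologyOf (TensorProduct.map f g.toLinearMap)
      ≃ₗ[K] (homologyOf f ⊗[K] W)) := by
  have h0 : (TensorProduct.map f g.toLinearMap) ∘ₗ (TensorProduct.map f g.toLinearMap) = 0 := by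
    rw [← TensorProduct.map_comp, hf, TensorProduct.map_zero_left]
  refine ⟨h0, FiniteDimensional.nonempty_linearEquiv_of_finrank_eq ?_⟩
  have h1 := finrank_homologyOf_add f hf
  have h2 := finrank_homologyOf_add _ h0
  rw [finrank_range_map_equiv, Module.finrank_tensorProduct, ← h1] at h2
  rw [Module.finrank_tensorProduct]
  nlinarith
end

section
/- Fix n ≥ 1 and work over 𝔽₂ = ZMod 2. Let V be the 𝔽₂-vector space of functions ((Fin 4 × ZMod n) ⊕ Fin 2) → ZMod 2, with standard basis vectors e(i, j) for i ∈ Fin 4 and j ∈ ZMod n, together with two further basis vectors f₀ and f₁. Let d : V →ₗ[𝔽₂] V be the unique linear map with d(e(0, j)) = e(3, j + 1) for all j ∈ ZMod n, and d = 0 on all other basis vectors (including f₀ and f₁). Then d ∘ d = 0 and the homology ker(d) ⧸ im(d) has 𝔽₂-dimension 2n + 2. (This is the paper's computation of ĤFO for the 3-orbifold obtained from 0-surgery on the figure-eight knot with singular multiplicity n: the complex splits as a rank-2 piece with trivial differential coming from the unstable chain, corresponding to f₀, f₁, plus generators λ¹₁ ⊗ x_j, λ³₁ ⊗ x_j, κ¹₁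 ⊗ x_j, κ³₁ ⊗ x_j with only nontrivial differential ∂(λ¹₁ ⊗ x_j) = κ³₁ ⊗ x_{j+1}; the resulting rank 2n + 2 = n · rank ĤF(Y) − 2n + 2 agrees with Theorem 2, since ε(figure-eight) = 0 and rank ĤF(S³₀(4₁)) = 4.) -/
open TensorProduct

/-- The dimension of the homology `ker D ⧸ im D` of a linear endomorphism. -/
noncomputable def homologyDim {K : Type} [Field K] {V : Type} [AddCommGroup V]
    [Module K V] (D : V →ₗ[K] V) : ℕ :=
  Module.finrank K
    (LinearMap.ker D ⧸ (LinearMap.range D).comap (LinearMap.ker D).subtype)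

theorem stmt7 (n : ℕ) (hn : 1 ≤ n)
    (d : (((Fin 4 × ZMod n) ⊕ Fin 2) → ZMod 2)
      →ₗ[ZMod 2] (((Fin 4 × ZMod n) ⊕ Fin 2) → ZMod 2))
    (h0 : ∀ j : ZMod n,
      d (Pi.single (Sum.inl ((0 : Fin 4), j)) 1)
        = Pi.single (Sum.inl ((3 : Fin 4), j + 1)) 1)
    (hrest : ∀ i : Fin 4, i ≠ 0 →
      ∀ j : ZMod n, d (Pi.single (Sum.inl (i, j)) 1) = 0)
    (hf : ∀ k : Fin 2, d (Pi.single (Sum.inr k) 1) = 0) :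
    d ∘ₗ d = 0 ∧ homologyDim d = 2 * n + 2 := by
  haveI : NeZero n := ⟨by omega⟩
  have hdd : d ∘ₗ d = 0 := by
    apply (Pi.basisFun (ZMod 2) ((Fin 4 × ZMod n) ⊕ Fin 2)).ext
    rintro (⟨i, j⟩ | k)
    · rw [Pi.basisFun_apply, LinearMap.comp_apply]
      by_cases hi : i = 0
      · subst hi
        rw [h0, hrest 3 (by decide)]
        rfl
      · rw [hrest i hi, map_zero]
        rfl
    · rw [Pi.basisFun_apply, LinearMap.comp_apply, hf, map_zero]
      rfl
  refine ⟨hdd, ?_⟩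
  have hrange : LinearMap.range d = Submodule.span (ZMod 2)
      (Set.range (fun j : ZMod n =>
        Pi.basisFun (ZMod 2) ((Fin 4 × ZMod n) ⊕ Fin 2) (Sum.inl ((3 : Fin 4), j)))) := by
    apply le_antisymm
    · rw [LinearMap.range_eq_map, ← (Pi.basisFun (ZMod 2) ((Fin 4 × ZMod n) ⊕ Fin 2)).span_eq,
        Submodule.map_span, Submodule.span_le]
      rintro _ ⟨_, ⟨(⟨i, j⟩ | k), rfl⟩, rfl⟩
      · rw [Pi.basisFun_apply]
        by_cases hi : i = 0
        · subst hi
          rw [h0]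
          exact Submodule.subset_span ⟨j + 1, by simp only [Pi.basisFun_apply]⟩
        · rw [hrest i hi]
          exact Submodule.zero_mem _
      · rw [Pi.basisFun_apply, hf]
        exact Submodule.zero_mem _
    · rw [Submodule.span_le]
      rintro _ ⟨j, rfl⟩
      refine ⟨Pi.single (Sum.inl ((0 : Fin 4), j - 1)) 1, ?_⟩
      rw [h0, sub_add_cancel]
      simp only [Pi.basisFun_apply]
  have hr : Module.finrank (ZMod 2) (LinearMap.range d) = n := by
    rw [hrange, finrank_span_eq_card, ZMod.card]
    refine (Pi.basisFun (ZMod 2) ((Fin 4 × ZMod n) ⊕ Fin 2)).linearIndependent.comp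
      (fun j : ZMod n => Sum.inl ((3 : Fin 4), j)) ?_
    intro a b h
    simpa using h
  have hle : LinearMap.range d ≤ LinearMap.ker d := LinearMap.range_le_ker_iff.mpr hdd
  have h1 := LinearMap.finrank_range_add_finrank_ker d
  have h2 := Submodule.finrank_quotient_add_finrank
    ((LinearMap.range d).comap (LinearMap.ker d).subtype)
  have h3 := (Submodule.comapSubtypeEquivOfLe hle).finrank_eq
  rw [Module.finrank_fintype_fun_eq_card, Fintype.card_sum, Fintype.card_prod, ZMod.card,
    Fintype.card_fin, Fintype.card_fin] at h1
  unfold homologyDim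
  rw [h3] at h2
  omega
end

section
/- Let n ≥ 1 and work over 𝔽₂ = ZMod 2. Let V be a finite-dimensional 𝔽₂-vector space with a ℤ/2-grading V = V₀ ⊕ V₁, and let d : V →ₗ[𝔽₂] V be an odd differential: d(V₀) ⊆ V₁, d(V₁) ⊆ V₀, and d ∘ d = 0. Let W_n = (Fin n → ZMod 2) with σ the cyclic shift, and grade C = V ⊗[𝔽₂] W_n by declaring C₀ = V₁ ⊗ W_n and C₁ = V₀ ⊗ W_n (each tensor factor from W_n is placed in degree 1). Then D = TensorProduct.map d σ is an odd differential on C with D ∘ D = 0, and the graded homologies satisfy |dim H₀(D) − dim H₁(D)| = n · |dim H₀(d) − dim H₁(d)|, where H_ε of an odd differential δ on a graded space is (ker δ ∩ (degree-ε part)) ⧸ δ(degree-(1−ε) part). (This is the computational core of Lemma 5.1 of the paper: with the relative ℤ₂-grading gr^orb(y ⊗ x_i) = gr_A(y) + gr_D^orb(x_i), where gr_D^orb(x_i) = 1 for all i, one gets |χ(ĤFO(Y^orb))| = n · |χ(ĤF(|Y^orb|))|, which is the key step in the categorification Theorem 3.) -/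
open TensorProduct

/-- The cyclic shift on `Fin n → ZMod 2`, sending the `j`-th standard basis
vector `e_j` to `e_{j+1}`, indices mod `n`. -/
def cyclicShift (n : ℕ) [NeZero n] :
    (Fin n → ZMod 2) →ₗ[ZMod 2] (Fin n → ZMod 2) :=
  LinearMap.funLeft (ZMod 2) (ZMod 2) (fun k => k - 1)

/-- For an odd differential `δ` on a `ℤ/2`-graded space with degree-`ε` part `A`
and degree-`(1-ε)` part `B`, the dimension of the degree-`ε` homology
`(ker δ ∩ A) ⧸ δ(B)`. -/
noncomputable def gradedHomologyDim {V : Type} [AddCommGroup V] [Module (ZMod 2) V]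
    (δ : V →ₗ[ZMod 2] V) (A B : Submodule (ZMod 2) V) : ℕ :=
  Module.finrank (ZMod 2)
    (↥(LinearMap.ker δ ⊓ A) ⧸
      (Submodule.map δ B).comap (LinearMap.ker δ ⊓ A).subtype)

theorem ghd_add {V : Type} [AddCommGroup V] [Module (ZMod 2) V] [FiniteDimensional (ZMod 2) V]
    (δ : V →ₗ[ZMod 2] V) (A B : Submodule (ZMod 2) V)
    (hBA : ∀ x ∈ B, δ x ∈ A) (hdd : δ ∘ₗ δ = 0) :
    gradedHomologyDim δ A B + Module.finrank (ZMod 2) (Submodule.map δ B)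
      + Module.finrank (ZMod 2) (Submodule.map δ A) = Module.finrank (ZMod 2) A := by
  have hle : Submodule.map δ B ≤ LinearMap.ker δ ⊓ A := by
    rintro _ ⟨x, hx, rfl⟩
    exact ⟨LinearMap.congr_fun hdd x, hBA x hx⟩
  have h1 := Submodule.finrank_quotient_add_finrank
    ((Submodule.map δ B).comap (LinearMap.ker δ ⊓ A).subtype)
  rw [(Submodule.comapSubtypeEquivOfLe hle).finrank_eq] at h1
  have h2 := LinearMap.finrank_range_add_finrank_ker (δ.domRestrict A)
  have h3 : LinearMap.range (δ.domRestrict A) = Submodule.map δ A := by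
    rw [LinearMap.domRestrict, LinearMap.range_comp, Submodule.range_subtype]
  have h4 : LinearMap.ker (δ.domRestrict A) = (LinearMap.ker δ ⊓ A).comap A.subtype := by
    ext x; simp
  rw [h3, h4, (Submodule.comapSubtypeEquivOfLe inf_le_right).finrank_eq] at h2
  unfold gradedHomologyDim
  omega

theorem euler_eq {V : Type} [AddCommGroup V] [Module (ZMod 2) V] [FiniteDimensional (ZMod 2) V]
    (δ : V →ₗ[ZMod 2] V) (A B : Submodule (ZMod 2) V)
    (hAB : ∀ x ∈ A, δ x ∈ B) (hBA : ∀ x ∈ B, δ x ∈ A) (hdd : δ ∘ₗ δ = 0) :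
    (gradedHomologyDim δ A B : ℤ) - gradedHomologyDim δ B A
      = (Module.finrank (ZMod 2) A : ℤ) - Module.finrank (ZMod 2) B := by
  have h1 := ghd_add δ A B hBA hdd
  have h2 := ghd_add δ B A hAB hdd
  omega

theorem finrank_part (n : ℕ) {V : Type} [AddCommGroup V] [Module (ZMod 2) V]
    [FiniteDimensional (ZMod 2) V] (A : Submodule (ZMod 2) V) :
    Module.finrank (ZMod 2) (LinearMap.range (TensorProduct.map A.subtype
      (LinearMap.id : (Fin n → ZMod 2) →ₗ[ZMod 2] (Fin n → ZMod 2))))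
      = Module.finrank (ZMod 2) A * n := by
  rw [LinearMap.finrank_range_of_inj]
  · simp
  · exact Module.Flat.rTensor_preserves_injective_linearMap (M := Fin n → ZMod 2) A.subtype
      A.subtype_injective

theorem map_part (n : ℕ) {V : Type} [AddCommGroup V] [Module (ZMod 2) V]
    (A B : Submodule (ZMod 2) V) (d : V →ₗ[ZMod 2] V) (h : ∀ x ∈ A, d x ∈ B)
    (s : (Fin n → ZMod 2) →ₗ[ZMod 2] (Fin n → ZMod 2)) :
    ∀ x ∈ LinearMap.range (TensorProduct.map A.subtype
      (LinearMap.id : (Fin n → ZMod 2) →ₗ[ZMod 2] (Fin n → ZMod 2))),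
      TensorProduct.map d s x ∈ LinearMap.range (TensorProduct.map B.subtype
      (LinearMap.id : (Fin n → ZMod 2) →ₗ[ZMod 2] (Fin n → ZMod 2))) := by
  rintro _ ⟨y, rfl⟩
  induction y using TensorProduct.induction_on with
  | zero => simp
  | add a b ha hb => rw [map_add, map_add]; exact add_mem ha hb
  | tmul a w => exact ⟨(⟨d a, h a a.2⟩ : B) ⊗ₜ s w, by simp⟩

theorem stmt8 (n : ℕ) [NeZero n] (hn : 1 ≤ n)
    (V : Type) [AddCommGroup V] [Module (ZMod 2) V] [FiniteDimensional (ZMod 2) V]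
    (V₀ V₁ : Submodule (ZMod 2) V)
    (hsup : V₀ ⊔ V₁ = ⊤) (hinf : V₀ ⊓ V₁ = ⊥)
    (d : V →ₗ[ZMod 2] V)
    (hd01 : ∀ x ∈ V₀, d x ∈ V₁) (hd10 : ∀ x ∈ V₁, d x ∈ V₀)
    (hdd : d ∘ₗ d = 0) :
    let D := TensorProduct.map d (cyclicShift n)
    let C₀ := LinearMap.range (TensorProduct.map V₁.subtype
      (LinearMap.id : (Fin n → ZMod 2) →ₗ[ZMod 2] (Fin n → ZMod 2)))
    let C₁ := LinearMap.range (TensorProduct.map V₀.subtype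
      (LinearMap.id : (Fin n → ZMod 2) →ₗ[ZMod 2] (Fin n → ZMod 2)))
    (∀ x ∈ C₀, D x ∈ C₁) ∧ (∀ x ∈ C₁, D x ∈ C₀) ∧ D ∘ₗ D = 0 ∧
    |(gradedHomologyDim D C₀ C₁ : ℤ) - (gradedHomologyDim D C₁ C₀ : ℤ)|
      = n * |(gradedHomologyDim d V₀ V₁ : ℤ) - (gradedHomologyDim d V₁ V₀ : ℤ)| := by
  intro D C₀ C₁
  have h01 : ∀ x ∈ C₀, D x ∈ C₁ := map_part n V₁ V₀ d hd10 _
  have h10 : ∀ x ∈ C₁, D x ∈ C₀ := map_part n V₀ V₁ d hd01 _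
  have hDD : D ∘ₗ D = 0 := by
    rw [← TensorProduct.map_comp, hdd, TensorProduct.map_zero_left]
  refine ⟨h01, h10, hDD, ?_⟩
  rw [euler_eq D C₀ C₁ h01 h10 hDD, euler_eq d V₀ V₁ hd01 hd10 hdd,
    finrank_part n V₁, finrank_part n V₀, abs_sub_comm]
  push_cast
  rw [← sub_mul, abs_mul, Nat.abs_cast, mul_comm]
end
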